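/- Let n ≥ 2, let E₁, …, Eₙ be alphabets, let E_s = ∪_{i≠j}(Eᵢ ∩ Eⱼ), and let E_k satisfy E_s ⊆ E_k ⊆ E := E₁ ∪ … ∪ Eₙ. For i = 1, …, n let (Kᵢ, Nᵢ) model a nonblocking generator over Eᵢ (so Nᵢ = overline(Kᵢ)) and let (K_k, N_k) model a nonblocking generator over E_k (so N_k = overline(K_k)). Assume K_k ⊆ ∩_{i=1}^{n} P_k(Kᵢ). Set K = K₁ ∥ … ∥ Kₙ ∥ K_k and N = N₁ ∥ … ∥ Nₙ ∥ N_k. Then overline(K) = N if and only if both: (1) for every i = 1, …, n, overline(Kᵢ ∥ K_k) = Nᵢ ∥ N_k; and (2) overline(K) is conditionally decomposable with respect to E₁, …, Eₙ and E_k. -/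

import Mathlib

/- Language-theoretic model of discrete-event systems:
   strings over a finite alphabet (a `Finset` of symbols) are lists,
   natural projections erase letters outside the target alphabet,
   and the parallel composition is the standard synchronous composition. -/

namespace DES

variable {A : Type} [DecidableEq A]

/-- `star E` is `E*`: the set of finite strings over the alphabet `E`. -/
def star (E : Finset A) : Set (List A) :=
  {w | ∀ a ∈ w, a ∈ E}

/-- The natural projection onto `E₀`: it keeps letters of `E₀` and erases all
other letters. -/
def proj (E₀ : Finset A) (w : List A) : List A :=
  w.filter (· ∈ E₀)

/-- The inverse image `P⁻¹(L) = { s ∈ E* : P(s) ∈ L }` of the natural projection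
from `E*` onto `E₀*`. -/
def invProj (E E₀ : Finset A) (L : Set (List A)) : Set (List A) :=
  {s | s ∈ star E ∧ proj E₀ s ∈ L}

/-- Parallel composition `L₁ ∥ L₂ = P₁⁻¹(L₁) ∩ P₂⁻¹(L₂) ⊆ (E₁ ∪ E₂)*` of
`L₁ ⊆ E₁*` and `L₂ ⊆ E₂*`. -/
def par (E₁ E₂ : Finset A) (L₁ L₂ : Set (List A)) : Set (List A) :=
  invProj (E₁ ∪ E₂) E₁ L₁ ∩ invProj (E₁ ∪ E₂) E₂ L₂

/-- Parallel composition of a finite family `L i ⊆ (E i)*`. -/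
def parFam {ι : Type} [Fintype ι] (E : ι → Finset A) (L : ι → Set (List A)) :
    Set (List A) :=
  {w | w ∈ star (Finset.univ.sup E) ∧ ∀ i, proj (E i) w ∈ L i}

/-- The prefix closure of a language. -/
def pref (L : Set (List A)) : Set (List A) :=
  {w | ∃ u, w ++ u ∈ L}

/-- `K` is conditionally decomposable w.r.t. the alphabets `E i` and `Ek`:
`K = P_{1+k}(K) ∥ ⋯ ∥ P_{n+k}(K)`. -/
def condDecomp {ι : Type} [Fintype ι] (E : ι → Finset A) (Ek : Finset A)
    (K : Set (List A)) : Prop :=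
  K = parFam (fun i => E i ∪ Ek) (fun i => proj (E i ∪ Ek) '' K)

/-- Conditional decomposability for two components:
`K = P_{1+k}(K) ∥ P_{2+k}(K)`. -/
def condDecomp2 (E₁ E₂ Ek : Finset A) (K : Set (List A)) : Prop :=
  K = par (E₁ ∪ Ek) (E₂ ∪ Ek) (proj (E₁ ∪ Ek) '' K) (proj (E₂ ∪ Ek) '' K)

/-- The natural projection from `E'*` onto `E₀*` is an `L`-observer. -/
def observer (E' E₀ : Finset A) (L : Set (List A)) : Prop :=
  ∀ t ∈ proj E₀ '' L, ∀ s ∈ pref L, proj E₀ s <+: t →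
    ∃ u ∈ star E', s ++ u ∈ L ∧ proj E₀ (s ++ u) = t

/-- Letter-to-letter renaming map: letters in `Ekeep` are kept, all other
letters are renamed by `g`. -/
def ren (Ekeep : Finset A) (g : A → A) (w : List A) : List A :=
  w.map (fun a => if a ∈ Ekeep then a else g a)


theorem proj_append (F : Finset A) (u v : List A) :
    proj F (u ++ v) = proj F u ++ proj F v :=
  List.filter_append ..

theorem proj_proj_of_subset {F G : Finset A} (h : F ⊆ G) (w : List A) :
    proj F (proj G w) = proj F w := by
  unfold proj
  rw [List.filter_filter]
  refine List.filter_congr fun a _ => ?_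
  by_cases ha : a ∈ F
  · simp [ha, h ha]
  · simp [ha]

theorem proj_eq_self {F : Finset A} {w : List A} (h : w ∈ star F) : proj F w = w :=
  List.filter_eq_self.2 fun a ha => by simpa using h a ha

theorem proj_mem_star (F : Finset A) (w : List A) : proj F w ∈ star F := fun a ha => by
  simpa using (List.mem_filter.1 ha).2

theorem proj_eq_append {F : Finset A} {w u v : List A} (h : proj F w = u ++ v) :
    ∃ c d, w = c ++ d ∧ proj F c = u ∧ proj F d = v :=
  List.filter_eq_append_iff.1 h

theorem star_mono {B : Type} {F G : Finset B} (h : F ⊆ G) : star F ⊆ star G :=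
  fun _ hw a ha => h (hw a ha)

theorem mem_star_append {B : Type} {F : Finset B} {u v : List B} :
    u ++ v ∈ star F ↔ u ∈ star F ∧ v ∈ star F :=
  List.forall_mem_append

theorem mem_star_cons {B : Type} {F : Finset B} {a : B} {v : List B} :
    a :: v ∈ star F ↔ a ∈ F ∧ v ∈ star F :=
  List.forall_mem_cons

theorem pref_subset_star {B : Type} {F : Finset B} {L : Set (List B)} (h : L ⊆ star F) :
    pref L ⊆ star F := by
  rintro w ⟨u, hu⟩
  exact (mem_star_append.1 (h hu)).1

theorem proj_cons_of_mem {F : Finset A} {a : A} (h : a ∈ F) (w : List A) :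
    proj F (a :: w) = a :: proj F w :=
  List.filter_cons_of_pos (by simpa using h)

theorem proj_cons_of_notMem {F : Finset A} {a : A} (h : a ∉ F) (w : List A) :
    proj F (a :: w) = proj F w :=
  List.filter_cons_of_neg (by simpa using h)

/-- Two words that agree on a set of letters containing all their shared letters have a common
interleaving. -/
theorem exists_merge {F G C : Finset A} (hFG : F ∩ G ⊆ C)
    (x y : List A) (hx : x ∈ star F) (hy : y ∈ star G) (hxy : proj C x = proj C y) :
    ∃ w ∈ star (F ∪ G), proj F w = x ∧ proj G w = y := by
  induction x generalizing y with
  | nil =>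
    refine ⟨y, star_mono Finset.subset_union_right hy, ?_, proj_eq_self hy⟩
    refine List.filter_eq_nil_iff.2 fun a ha => ?_
    have := List.filter_eq_nil_iff.1 hxy.symm a ha
    simp only [decide_eq_true_eq] at this ⊢
    exact fun haF => this (hFG (Finset.mem_inter.2 ⟨haF, hy a ha⟩))
  | cons a x ihx =>
    obtain ⟨haF, hx'⟩ := mem_star_cons.1 hx
    by_cases haC : a ∈ C
    · induction y with
      | nil =>
        rw [proj_cons_of_mem haC] at hxy
        exact absurd hxy (List.cons_ne_nil _ _)
      | cons b y ihy =>
        obtain ⟨hbG, hy'⟩ := mem_star_cons.1 hy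
        by_cases hbC : b ∈ C
        · rw [proj_cons_of_mem haC, proj_cons_of_mem hbC] at hxy
          obtain ⟨rfl, hxy'⟩ := List.cons.inj hxy
          obtain ⟨w, hw, h1, h2⟩ := ihx y hx' hy' hxy'
          refine ⟨a :: w, mem_star_cons.2 ⟨Finset.mem_union_left _ haF, hw⟩, ?_, ?_⟩
          · rw [proj_cons_of_mem haF, h1]
          · rw [proj_cons_of_mem hbG, h2]
        · have hbF : b ∉ F := fun h => hbC (hFG (Finset.mem_inter.2 ⟨h, hbG⟩))
          rw [proj_cons_of_notMem hbC] at hxy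
          obtain ⟨w, hw, h1, h2⟩ := ihy hy' hxy
          refine ⟨b :: w, mem_star_cons.2 ⟨Finset.mem_union_right _ hbG, hw⟩, ?_, ?_⟩
          · rw [proj_cons_of_notMem hbF, h1]
          · rw [proj_cons_of_mem hbG, h2]
    · have haG : a ∉ G := fun h => haC (hFG (Finset.mem_inter.2 ⟨haF, h⟩))
      rw [proj_cons_of_notMem haC] at hxy
      obtain ⟨w, hw, h1, h2⟩ := ihx y hx' hy hxy
      refine ⟨a :: w, mem_star_cons.2 ⟨Finset.mem_union_left _ haF, hw⟩, ?_, ?_⟩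
      · rw [proj_cons_of_mem haF, h1]
      · rw [proj_cons_of_notMem haG, h2]

/-- A family of words that agree on an alphabet containing all pairwise shared letters has a
common interleaving. -/
theorem exists_merge_family {ι : Type} [DecidableEq ι] {F : ι → Finset A} {C : Finset A}
    (hC : ∀ i, C ⊆ F i) (hF : ∀ i j, i ≠ j → F i ∩ F j ⊆ C) {x : ι → List A} {t : List A}
    (hx : ∀ i, x i ∈ star (F i)) (ht : t ∈ star C) (hxt : ∀ i, proj C (x i) = t)
    (s : Finset ι) :
    ∃ w ∈ star (C ∪ s.sup F), proj C w = t ∧ ∀ i ∈ s, proj (F i) w = x i := by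
  induction s using Finset.induction_on with
  | empty => exact ⟨t, star_mono Finset.subset_union_left ht, proj_eq_self ht, by simp⟩
  | insert i s his ih =>
    obtain ⟨y, hy, hyt, hyx⟩ := ih
    have hinter : F i ∩ (C ∪ s.sup F) ⊆ C := by
      intro a ha
      obtain ⟨hai, ha⟩ := Finset.mem_inter.1 ha
      rcases Finset.mem_union.1 ha with ha | ha
      · exact ha
      · obtain ⟨j, hj, haj⟩ := Finset.mem_sup.1 ha
        exact hF i j (fun h => his (h ▸ hj)) (Finset.mem_inter.2 ⟨hai, haj⟩)
    obtain ⟨w, hw, hwx, hwy⟩ := exists_merge hinter (x i) y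
      (hx i) hy ((hxt i).trans hyt.symm)
    refine ⟨w, star_mono ?_ hw, ?_, ?_⟩
    · rw [Finset.sup_insert, Finset.sup_eq_union]
      grind
    · rw [← proj_proj_of_subset (hC i), hwx, hxt]
    · intro j hj
      rcases Finset.mem_insert.1 hj with rfl | hj
      · exact hwx
      · rw [← hyx j hj, ← hwy, proj_proj_of_subset]
        exact (Finset.le_sup (f := F) hj).trans Finset.subset_union_right

/-- A word over `E i ∪ Ek` and words over the alphabets `E j` that all agree on `Ek` have a
common interleaving. -/
theorem exists_lift {ι : Type} [Fintype ι] [DecidableEq ι] {E : ι → Finset A} {Ek : Finset A}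
    (hs : ∀ i j, i ≠ j → E i ∩ E j ⊆ Ek) (hkE : Ek ⊆ Finset.univ.sup E)
    {v : ι → List A} (hv : ∀ j, v j ∈ star (E j)) {i : ι} {w : List A}
    (hw : w ∈ star (E i ∪ Ek)) (hvw : ∀ j, proj Ek (v j) = proj Ek w) :
    ∃ W ∈ star (Finset.univ.sup E), proj (E i ∪ Ek) W = w ∧
      ∀ j, j ≠ i → proj (E j) W = v j := by
  obtain ⟨W, hW, -, hWx⟩ := exists_merge_family (F := fun j => E j ∪ Ek) (C := Ek)
    (x := Function.update v i w) (t := proj Ek w)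
    (fun _ => Finset.subset_union_right)
    (fun j l hjl => by
      rw [← Finset.inter_union_distrib_right]
      exact Finset.union_subset (hs j l hjl) subset_rfl)
    (fun j => by
      rcases eq_or_ne j i with rfl | hj
      · simpa using hw
      · simpa [hj] using star_mono Finset.subset_union_left (hv j))
    (proj_mem_star _ _)
    (fun j => by
      rcases eq_or_ne j i with rfl | hj
      · simp
      · simp [hj, hvw])
    Finset.univ
  refine ⟨W, star_mono ?_ hW, by simpa using hWx i (Finset.mem_univ i), fun j hj => ?_⟩
  · refine Finset.union_subset hkE (Finset.sup_le fun j hj => ?_)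
    exact Finset.union_subset (Finset.le_sup (f := E) hj) hkE
  · have := hWx j (Finset.mem_univ j)
    rw [Function.update_of_ne hj] at this
    rw [← proj_proj_of_subset (Finset.subset_union_left (s₂ := Ek)), this, proj_eq_self (hv j)]

theorem mem_par {E₁ E₂ : Finset A} {L₁ L₂ : Set (List A)} {w : List A} :
    w ∈ par E₁ E₂ L₁ L₂ ↔ w ∈ star (E₁ ∪ E₂) ∧ proj E₁ w ∈ L₁ ∧ proj E₂ w ∈ L₂ := by
  simp only [par, invProj, Set.mem_inter_iff, Set.mem_ofPred_eq]
  tauto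

theorem mem_par_parFam {ι : Type} [Fintype ι] {E : ι → Finset A} {Ek : Finset A}
    (hkE : Ek ⊆ Finset.univ.sup E) {K : ι → Set (List A)} {Kk : Set (List A)} {w : List A} :
    w ∈ par (Finset.univ.sup E) Ek (parFam E K) Kk ↔
      w ∈ star (Finset.univ.sup E) ∧ (∀ i, proj (E i) w ∈ K i) ∧ proj Ek w ∈ Kk := by
  rw [mem_par, Finset.union_eq_left.2 hkE]
  refine and_congr_right fun hw => and_congr_left fun _ => ?_
  rw [proj_eq_self hw]
  exact ⟨fun h => h.2, fun h => ⟨hw, h⟩⟩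

theorem pref_par_subset (E₁ E₂ : Finset A) (L₁ L₂ : Set (List A)) :
    pref (par E₁ E₂ L₁ L₂) ⊆ par E₁ E₂ (pref L₁) (pref L₂) := by
  rintro w ⟨u, hu⟩
  obtain ⟨h, h1, h2⟩ := mem_par.1 hu
  rw [proj_append] at h1 h2
  exact mem_par.2 ⟨(mem_star_append.1 h).1, ⟨_, h1⟩, ⟨_, h2⟩⟩

theorem proj_mem_par {ι : Type} [Fintype ι] {E : ι → Finset A} {Ek : Finset A}
    (hkE : Ek ⊆ Finset.univ.sup E) {K : ι → Set (List A)} {Kk : Set (List A)} {w : List A}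
    (hw : w ∈ par (Finset.univ.sup E) Ek (parFam E K) Kk) (i : ι) :
    proj (E i ∪ Ek) w ∈ par (E i) Ek (K i) Kk := by
  obtain ⟨-, h1, h2⟩ := (mem_par_parFam hkE).1 hw
  refine mem_par.2 ⟨proj_mem_star _ _, ?_, ?_⟩
  · rw [proj_proj_of_subset Finset.subset_union_left]; exact h1 i
  · rw [proj_proj_of_subset Finset.subset_union_right]; exact h2

/-- If every word of `Lk` is matched by a word of each `L j`, then every word of `L i ∥ Lk`
is the projection of a word of the global composition. -/
theorem exists_proj_eq_of_mem_par {ι : Type} [Fintype ι] [DecidableEq ι] {E : ι → Finset A}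
    {Ek : Finset A} (hs : ∀ i j, i ≠ j → E i ∩ E j ⊆ Ek) (hkE : Ek ⊆ Finset.univ.sup E)
    {L : ι → Set (List A)} {Lk : Set (List A)} (hL : ∀ i, L i ⊆ star (E i))
    (hLk : ∀ i, Lk ⊆ proj Ek '' L i) {i : ι} {w : List A} (hw : w ∈ par (E i) Ek (L i) Lk) :
    ∃ W ∈ par (Finset.univ.sup E) Ek (parFam E L) Lk, proj (E i ∪ Ek) W = w := by
  obtain ⟨hw, h1, h2⟩ := mem_par.1 hw
  choose v hvL hv using fun j => hLk j h2
  obtain ⟨W, hW, hWi, hWj⟩ := exists_lift hs hkE (fun j => hL j (hvL j)) hw hv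
  refine ⟨W, (mem_par_parFam hkE).2 ⟨hW, fun j => ?_, ?_⟩, hWi⟩
  · rcases eq_or_ne j i with rfl | hj
    · rwa [← proj_proj_of_subset (Finset.subset_union_left (s₂ := Ek)), hWi]
    · rw [hWj j hj]; exact hvL j
  · rwa [← proj_proj_of_subset (Finset.subset_union_right (s₁ := E i)), hWi]

theorem pref_subset_image_proj_pref {F : Finset A} {L M : Set (List A)} (h : M ⊆ proj F '' L) :
    pref M ⊆ proj F '' pref L := by
  rintro t ⟨u, hu⟩
  obtain ⟨v, hv, hvt⟩ := h hu
  obtain ⟨c, d, rfl, hc, -⟩ := proj_eq_append hvt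
  exact ⟨c, ⟨d, hv⟩, hc⟩

theorem condDecomp_par_parFam {ι : Type} [Fintype ι] [Nonempty ι] {E : ι → Finset A}
    {Ek : Finset A} (hkE : Ek ⊆ Finset.univ.sup E) (L : ι → Set (List A)) (Lk : Set (List A)) :
    condDecomp E Ek (par (Finset.univ.sup E) Ek (parFam E L) Lk) := by
  have hle : Finset.univ.sup E ≤ Finset.univ.sup fun i => E i ∪ Ek :=
    Finset.sup_mono_fun fun _ _ => Finset.subset_union_left
  have hge : (Finset.univ.sup fun i => E i ∪ Ek) ≤ Finset.univ.sup E :=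
    Finset.sup_le fun j hj => Finset.union_subset (Finset.le_sup (f := E) hj) hkE
  refine Set.Subset.antisymm (fun w hw => ?_) fun w ⟨hw, hp⟩ => ?_
  · exact ⟨star_mono hle ((mem_par_parFam hkE).1 hw).1, fun i => ⟨w, hw, rfl⟩⟩
  · have key : ∀ i, proj (E i) w ∈ L i ∧ proj Ek w ∈ Lk := fun i => by
      obtain ⟨v, hv, hvw⟩ := hp i
      have := mem_par.1 (hvw ▸ proj_mem_par hkE hv i)
      rw [proj_proj_of_subset Finset.subset_union_left,
        proj_proj_of_subset Finset.subset_union_right] at this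
      exact this.2
    exact (mem_par_parFam hkE).2
      ⟨star_mono hge hw, fun i => (key i).1, (key (Classical.arbitrary ι)).2⟩

/-- Corollary 1: with nonblocking generators (`N i = overline(K i)`,
`Nk = overline(Kk)`) and `K_k ⊆ ∩ᵢ P_k(Kᵢ)`, the coordinated system is
nonblocking iff (1) each `Gᵢ ∥ G_k` is nonblocking and (2) `overline(K)` is
conditionally decomposable w.r.t. `E₁, …, Eₙ, E_k`. -/
theorem stmt13 {A : Type} [DecidableEq A] {n : ℕ} (hn : 2 ≤ n)
    (E : Fin n → Finset A) (Ek : Finset A)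
    (hs : ∀ i j, i ≠ j → E i ∩ E j ⊆ Ek)
    (hkE : Ek ⊆ Finset.univ.sup E)
    (K N : Fin n → Set (List A)) (Kk Nk : Set (List A))
    (hKE : ∀ i, K i ⊆ star (E i)) (hKkE : Kk ⊆ star Ek)
    (hNB : ∀ i, N i = pref (K i)) (hNBk : Nk = pref Kk)
    (hKk : Kk ⊆ ⋂ i, proj Ek '' K i)
    (GK GN : Set (List A))
    (hGK : GK = par (Finset.univ.sup E) Ek (parFam E K) Kk)
    (hGN : GN = par (Finset.univ.sup E) Ek (parFam E N) Nk) :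
    pref GK = GN ↔
      ((∀ i, pref (par (E i) Ek (K i) Kk) = par (E i) Ek (N i) Nk) ∧
        condDecomp E Ek (pref GK)) := by
  have : Nonempty (Fin n) := ⟨⟨0, by omega⟩⟩
  obtain rfl : N = fun i => pref (K i) := funext hNB
  subst hNBk hGK hGN
  have hKki : ∀ i, Kk ⊆ proj Ek '' K i := Set.subset_iInter_iff.1 hKk
  constructor
  · intro h
    refine ⟨fun i => (pref_par_subset ..).antisymm fun w hw => ?_, ?_⟩
    · obtain ⟨W, hW, rfl⟩ := exists_proj_eq_of_mem_par hs hkE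
        (fun j => pref_subset_star (hKE j))
        (fun j => pref_subset_image_proj_pref (hKki j)) hw
      rw [← h] at hW
      obtain ⟨U, hU⟩ := hW
      refine ⟨proj (E i ∪ Ek) U, ?_⟩
      rw [← proj_append]
      exact proj_mem_par hkE hU i
    · rw [h]
      exact condDecomp_par_parFam hkE _ _
  · rintro ⟨h1, h2⟩
    refine Set.Subset.antisymm ?_ fun w hw => ?_
    · rintro w ⟨u, hu⟩
      obtain ⟨hw, hK, hk⟩ := (mem_par_parFam hkE).1 hu
      simp only [proj_append] at hK hk
      exact (mem_par_parFam hkE).2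
        ⟨(mem_star_append.1 hw).1, fun i => ⟨_, hK i⟩, ⟨_, hk⟩⟩
    · rw [h2]
      refine ⟨star_mono (Finset.sup_mono_fun fun _ _ => Finset.subset_union_left)
        ((mem_par_parFam hkE).1 hw).1, fun i => ?_⟩
      have hwi := proj_mem_par hkE hw i
      rw [← h1 i] at hwi
      exact pref_subset_image_proj_pref
        (fun v hv => exists_proj_eq_of_mem_par hs hkE hKE hKki hv) hwi

end DES
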